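/- Let 𝕂 be ℝ or ℂ, let E be an infinite-dimensional Banach space over 𝕂, let n ≥ 2 be an integer, let m ≥ 1 be an integer, and let ε > 0. Then there exist vectors x₁, …, x_m in E such that for every tuple of scalars (α₁, …, α_m) ∈ 𝕂^m, max_{1≤i≤m} |α_i| ≤ sup{ |Σ_{i=1}^m α_i φ(x_i)^n| : φ ∈ E′, ‖φ‖ ≤ 1 } ≤ (1+ε)^n · max_{1≤i≤m} |α_i|. (In the language of the paper, the span of the tensors x_i⊗⋯⊗x_i in the n-fold symmetric injective tensor product of E is (1+ε)^n-isomorphic to ℓ∞^m; hence ℓ∞ is finitely represented in that tensor product and in the space 𝒫(ⁿE) of continuous n-homogeneous polynomials.) -/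

import Mathlib

theorem dr_extremal {𝕂 : Type*} [RCLike 𝕂] {F : Type*} [NormedAddCommGroup F]
    [NormedSpace 𝕂 F] [FiniteDimensional 𝕂 F] {N : ℕ} (hN : 0 < N)
    (hF : Module.finrank 𝕂 F = N) :
    ∃ T : EuclideanSpace 𝕂 (Fin N) →L[𝕂] F, ‖T‖ ≤ 1 ∧
      ∀ A : EuclideanSpace 𝕂 (Fin N) →L[𝕂] EuclideanSpace 𝕂 (Fin N),
        ‖A.det‖ ≤ ‖T ∘L A‖ ^ N := by
  have hfr : Module.finrank 𝕂 F = Module.finrank 𝕂 (EuclideanSpace 𝕂 (Fin N)) := by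
    simp [hF]
  let L : F ≃L[𝕂] EuclideanSpace 𝕂 (Fin N) := ContinuousLinearEquiv.ofFinrankEq hfr
  let f : (EuclideanSpace 𝕂 (Fin N) →L[𝕂] F) → ℝ :=
    fun T => ‖((L : F →L[𝕂] EuclideanSpace 𝕂 (Fin N)) ∘L T).det‖
  have hfc : Continuous f := by
    have h1 : Continuous fun T : EuclideanSpace 𝕂 (Fin N) →L[𝕂] F =>
        ((L : F →L[𝕂] EuclideanSpace 𝕂 (Fin N)) ∘L T) := by fun_prop
    exact (ContinuousLinearMap.continuous_det.comp h1).norm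
  have hprop : ProperSpace (EuclideanSpace 𝕂 (Fin N) →L[𝕂] F) :=
    FiniteDimensional.proper 𝕂 _
  have hsmul : ∀ (r : ℝ) (S : EuclideanSpace 𝕂 (Fin N) →L[𝕂] F),
      f ((r : 𝕂) • S) = |r| ^ N * f S := by
    intro r S
    simp only [f, ContinuousLinearMap.comp_smul, ContinuousLinearMap.det,
      ContinuousLinearMap.toLinearMap_smul]
    rw [LinearMap.det_smul, norm_mul, norm_pow, RCLike.norm_ofReal]
    simp
  obtain ⟨T, hT, hmax⟩ := (isCompact_closedBall
    (0 : EuclideanSpace 𝕂 (Fin N) →L[𝕂] F) 1).exists_isMaxOn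
    ⟨0, by simp⟩ hfc.continuousOn
  have hT1 : ‖T‖ ≤ 1 := by simpa using hT
  have hle : ∀ S : EuclideanSpace 𝕂 (Fin N) →L[𝕂] F, f S ≤ ‖S‖ ^ N * f T := by
    intro S
    by_cases hS : ‖S‖ = 0
    · have : S = 0 := by simpa using hS
      have h := hsmul 0 S
      simp [hN.ne'] at h
      simp [this, hN.ne', h]
    · have hS' : 0 < ‖S‖ := lt_of_le_of_ne (norm_nonneg _) (Ne.symm hS)
      have h1 : f (((‖S‖⁻¹ : ℝ) : 𝕂) • S) ≤ f T := by
        apply hmax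
        simp [norm_smul, hS]
      rw [hsmul, abs_of_pos (inv_pos.mpr hS'), inv_pow, inv_mul_le_iff₀ (by positivity)] at h1
      exact h1
  have hpos : 0 < f T := by
    have h0 : f (L.symm : EuclideanSpace 𝕂 (Fin N) →L[𝕂] F) = 1 := by
      simp only [f, ContinuousLinearEquiv.coe_comp_coe_symm]
      simp [ContinuousLinearMap.det]
    have := hle (L.symm : EuclideanSpace 𝕂 (Fin N) →L[𝕂] F)
    rw [h0] at this
    by_contra hcon
    have h2 : f T = 0 := le_antisymm (not_lt.mp hcon) (norm_nonneg _)
    rw [h2] at this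
    linarith
  refine ⟨T, hT1, fun A => ?_⟩
  have h1 := hle (T ∘L A)
  have h2 : f (T ∘L A) = ‖A.det‖ * f T := by
    simp only [f, ContinuousLinearMap.det]
    rw [← norm_mul, mul_comm, ← LinearMap.det_comp]
    rfl
  rw [h2] at h1
  exact le_of_mul_le_mul_right h1 hpos

theorem dr_step {𝕂 : Type*} [RCLike 𝕂] {F : Type*} [NormedAddCommGroup F]
    [NormedSpace 𝕂 F] {N : ℕ} (T : EuclideanSpace 𝕂 (Fin N) →L[𝕂] F) (hT : ‖T‖ ≤ 1)
    (hA : ∀ A : EuclideanSpace 𝕂 (Fin N) →L[𝕂] EuclideanSpace 𝕂 (Fin N),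
        ‖A.det‖ ≤ ‖T ∘L A‖ ^ N) {m : ℕ} {c a : ℝ} (hc : 0 ≤ c) (ha : 1 ≤ a) (hm : m ≤ N)
    (hlt : (1 + a * c) ^ N < a ^ (N - m)) (j : ℕ) (hj : j ≤ m) :
    ∃ b : OrthonormalBasis (Fin N) 𝕂 (EuclideanSpace 𝕂 (Fin N)),
      ∀ i : Fin N, (i : ℕ) < j → c ≤ ‖T (b i)‖ := by
  induction j with
  | zero => exact ⟨EuclideanSpace.basisFun _ _, by simp⟩
  | succ j ih =>
    obtain ⟨b, hb⟩ := ih (by omega)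
    let K : Submodule 𝕂 (EuclideanSpace 𝕂 (Fin N)) :=
      Submodule.span 𝕂 (b '' {i | (i : ℕ) < j})
    have hKmem : ∀ i : Fin N, (i : ℕ) < j → b i ∈ K := fun i hi =>
      Submodule.subset_span ⟨i, hi, rfl⟩
    have hKperp : ∀ i : Fin N, ¬ (i : ℕ) < j → b i ∈ Kᗮ := by
      intro i hi
      rw [Submodule.mem_orthogonal]
      intro u hu
      induction hu using Submodule.span_induction with
      | mem x h =>
        obtain ⟨k, hk, rfl⟩ := h
        rw [b.inner_eq_zero]
        rintro rfl
        exact hi hk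
      | zero => simp
      | add x y _ _ h1 h2 => simp [inner_add_left, h1, h2]
      | smul r x _ h => simp [inner_smul_left, h]
    have key : ∃ h ∈ Kᗮ, c * ‖h‖ < ‖T h‖ := by
      by_contra! hcon
      let A : EuclideanSpace 𝕂 (Fin N) →L[𝕂] EuclideanSpace 𝕂 (Fin N) :=
        K.starProjection + (a : 𝕂) • Kᗮ.starProjection
      have hdet : A.det = (a : 𝕂) ^ (N - j) := by
        have hM : LinearMap.toMatrix b.toBasis b.toBasis (A : _ →ₗ[𝕂] _) =
            Matrix.diagonal (fun i : Fin N => if (i : ℕ) < j then (1 : 𝕂) else (a : 𝕂)) := by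
          ext i k
          have : A (b k) = (if (k : ℕ) < j then (1 : 𝕂) else (a : 𝕂)) • b k := by
            split_ifs with h
            · have h1 := K.starProjection_eq_self_iff.mpr (hKmem k h)
              have h2 : Kᗮ.starProjection (b k) = 0 := by
                rw [Submodule.starProjection_apply_eq_zero_iff]
                exact K.le_orthogonal_orthogonal (hKmem k h)
              simp [A, h1, h2]
            · have h1 := Kᗮ.starProjection_eq_self_iff.mpr (hKperp k h)
              have h2 : K.starProjection (b k) = 0 := by
                rw [Submodule.starProjection_apply_eq_zero_iff]
                exact hKperp k h
              simp [A, h1, h2]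
          rw [LinearMap.toMatrix_apply]
          simp only [OrthonormalBasis.coe_toBasis, ContinuousLinearMap.coe_coe, this]
          rw [map_smul, ← OrthonormalBasis.coe_toBasis, Module.Basis.repr_self]
          rw [Finsupp.smul_apply, smul_eq_mul]
          by_cases hik : i = k
          · subst hik; simp
          · rw [Matrix.diagonal_apply_ne _ hik, Finsupp.single_eq_of_ne hik, mul_zero]
        rw [ContinuousLinearMap.det, ← LinearMap.det_toMatrix b.toBasis, hM, Matrix.det_diagonal,
          Finset.prod_ite]
        simp only [Finset.prod_const_one, one_mul, Finset.prod_const]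
        congr 1
        have h1 := Finset.card_filter_add_card_filter_not (s := (Finset.univ : Finset (Fin N)))
          (fun i : Fin N => (i : ℕ) < j)
        have h2 : (Finset.univ.filter (fun i : Fin N => (i : ℕ) < j)).card = j := by
          rw [Fin.card_filter_val_lt]; omega
        simp at h1 h2 ⊢
        omega
      have hnorm : ‖T ∘L A‖ ≤ 1 + a * c := by
        refine ContinuousLinearMap.opNorm_le_bound _ (by positivity) fun x => ?_
        have e1 : (T ∘L A) x = T (K.starProjection x) + (a : 𝕂) • T (Kᗮ.starProjection x) := by
          rw [← map_smul, ← map_add]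
          rfl
        have hx1 : ‖K.starProjection x‖ ≤ ‖x‖ := by
          simpa using K.starProjection.le_of_opNorm_le K.starProjection_norm_le x
        have hx2 : ‖Kᗮ.starProjection x‖ ≤ ‖x‖ := by
          simpa using Kᗮ.starProjection.le_of_opNorm_le Kᗮ.starProjection_norm_le x
        have e2 : ‖T (K.starProjection x)‖ ≤ ‖x‖ := by
          have := T.le_of_opNorm_le hT (K.starProjection x)
          linarith
        have e3 := hcon (Kᗮ.starProjection x) (Submodule.starProjection_apply_mem _ _)
        have e4 : c * ‖Kᗮ.starProjection x‖ ≤ c * ‖x‖ := by gcongr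
        rw [e1]
        refine (norm_add_le _ _).trans ?_
        rw [norm_smul, RCLike.norm_ofReal, abs_of_nonneg (by linarith)]
        have : a * ‖T (Kᗮ.starProjection x)‖ ≤ a * (c * ‖x‖) := by
          gcongr
          linarith
        linarith
      have h1 := hA A
      rw [hdet, norm_pow, RCLike.norm_ofReal, abs_of_nonneg (by linarith)] at h1
      have h2 : a ^ (N - m) ≤ a ^ (N - j) := pow_le_pow_right₀ ha (by omega)
      have h3 : ‖T ∘L A‖ ^ N ≤ (1 + a * c) ^ N := by gcongr
      linarith
    obtain ⟨h, hK, hh⟩ := key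
    have hne : h ≠ 0 := by rintro rfl; simp at hh
    have hnh : 0 < ‖h‖ := norm_pos_iff.mpr hne
    let g := ((‖h‖⁻¹ : ℝ) : 𝕂) • h
    have hg1 : ‖g‖ = 1 := by simp [g, norm_smul, hnh.ne']
    have hgT : c ≤ ‖T g‖ := by
      simp only [g, map_smul, norm_smul, RCLike.norm_ofReal, abs_of_pos (inv_pos.mpr hnh)]
      rw [le_inv_mul_iff₀ hnh]
      linarith
    have hgK : g ∈ Kᗮ := Submodule.smul_mem _ _ hK
    have hjN : j < N := by omega
    let v : Fin N → EuclideanSpace 𝕂 (Fin N) := Function.update b ⟨j, hjN⟩ g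
    have hvj : v ⟨j, hjN⟩ = g := by simp [v]
    have hvi : ∀ i : Fin N, (i : ℕ) < j → v i = b i := by
      intro i hi
      have : i ≠ ⟨j, hjN⟩ := by rintro rfl; simp at hi
      simp [v, this]
    have hon : Orthonormal 𝕂 (({i : Fin N | (i : ℕ) < j + 1}).domRestrict v) := by
      constructor
      · rintro ⟨i, hi⟩
        rcases Nat.lt_succ_iff_lt_or_eq.mp hi with h | h
        · simp [Set.domRestrict_apply, hvi i h]
        · have : i = ⟨j, hjN⟩ := Fin.ext h
          subst this
          simp [Set.domRestrict_apply, hvj, hg1]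
      · rintro ⟨i, hi⟩ ⟨k, hk⟩ hik
        have hik' : i ≠ k := fun h => hik (Subtype.ext h)
        simp only [Set.domRestrict_apply]
        rcases Nat.lt_succ_iff_lt_or_eq.mp hi with h | h <;>
          rcases Nat.lt_succ_iff_lt_or_eq.mp hk with h' | h'
        · rw [hvi i h, hvi k h', b.inner_eq_zero hik']
        · have : k = ⟨j, hjN⟩ := Fin.ext h'
          rw [hvi i h, this, hvj]
          exact (Submodule.mem_orthogonal _ _).mp hgK _ (hKmem i h)
        · have : i = ⟨j, hjN⟩ := Fin.ext h
          rw [hvi k h', this, hvj]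
          exact (Submodule.mem_orthogonal' _ _).mp hgK _ (hKmem k h')
        · exact absurd (Fin.ext (h.trans h'.symm)) hik'
    obtain ⟨b', hb'⟩ := hon.exists_orthonormalBasis_extension_of_card_eq (by simp)
    refine ⟨b', fun i hi => ?_⟩
    rw [hb' i hi]
    rcases Nat.lt_succ_iff_lt_or_eq.mp hi with h | h
    · rw [hvi i h]; exact hb i h
    · have : i = ⟨j, hjN⟩ := Fin.ext h
      rw [this, hvj]; exact hgT

theorem dr_core {𝕂 : Type*} [RCLike 𝕂] {E : Type*} [NormedAddCommGroup E]
    [NormedSpace 𝕂 E] (hinf : ¬ FiniteDimensional 𝕂 E) {m : ℕ} (hm : 0 < m)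
    {δ : ℝ} (hδ : 0 < δ) :
    ∃ y : Fin m → E, (∀ i, ‖y i‖ = 1) ∧
      ∀ φ : E →L[𝕂] 𝕂, ‖φ‖ ≤ 1 → ∑ i, ‖φ (y i)‖ ^ 2 ≤ 1 + δ := by
  obtain ⟨c, hc0, hc1, hcδ⟩ : ∃ c : ℝ, 0 < c ∧ c < 1 ∧ (c ^ 2)⁻¹ = 1 + δ := by
    refine ⟨(√(1 + δ))⁻¹, by positivity, ?_, ?_⟩
    · apply inv_lt_one_of_one_lt₀
      rw [Real.lt_sqrt (by norm_num)]
      linarith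
    · rw [inv_pow, inv_inv, Real.sq_sqrt (by positivity)]
  obtain ⟨a, ha⟩ : ∃ a : ℝ, a = 2 / (1 - c) := ⟨_, rfl⟩
  have h1c : 0 < 1 - c := by linarith
  have ha1 : 1 ≤ a := by
    rw [ha, le_div_iff₀ h1c]; linarith
  have ha0 : 0 < a := by linarith
  have hac : 1 + a * c = a * ((1 + c) / 2) := by
    rw [ha]; field_simp; ring
  obtain ⟨N₀, hN₀⟩ := exists_pow_lt_of_lt_one (show 0 < (a ^ m)⁻¹ by positivity)
    (show (1 + c) / 2 < 1 by linarith)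
  obtain ⟨N, hN⟩ : ∃ N, N = N₀ + m := ⟨_, rfl⟩
  have hmN : m ≤ N := by omega
  have hlt : (1 + a * c) ^ N < a ^ (N - m) := by
    have h1 : ((1 + c) / 2) ^ N < (a ^ m)⁻¹ :=
      lt_of_le_of_lt (pow_le_pow_of_le_one (by linarith) (by linarith) (by omega)) hN₀
    rw [hac, mul_pow, pow_sub₀ _ ha0.ne' hmN]
    gcongr
  have hrank : (N : Cardinal) ≤ Module.rank 𝕂 E := by
    have : Cardinal.aleph0 ≤ Module.rank 𝕂 E := by
      by_contra h
      exact hinf (Module.rank_lt_aleph0_iff.mp (not_le.mp h))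
    exact (Cardinal.natCast_lt_aleph0).le.trans this
  obtain ⟨w, hw⟩ := exists_linearIndependent_of_le_rank hrank
  let F : Submodule 𝕂 E := Submodule.span 𝕂 (Set.range w)
  have hF : Module.finrank 𝕂 F = N := by
    simpa using finrank_span_eq_card hw
  have hfd : FiniteDimensional 𝕂 F := FiniteDimensional.span_of_finite 𝕂 (Set.finite_range w)
  obtain ⟨T, hT, hA⟩ := dr_extremal (by omega) hF
  obtain ⟨b, hb⟩ := dr_step T hT hA hc0.le ha1 hmN hlt m le_rfl
  let e : Fin m → Fin N := Fin.castLE hmN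
  have he : ∀ i, c ≤ ‖(T (b (e i)) : E)‖ := fun i => hb (e i) (by simp [e])
  refine ⟨fun i => ((‖(T (b (e i)) : E)‖⁻¹ : ℝ) : 𝕂) • (T (b (e i)) : E), ?_, ?_⟩
  · intro i
    have : 0 < ‖(T (b (e i)) : E)‖ := hc0.trans_le (he i)
    rw [norm_smul, RCLike.norm_ofReal, abs_of_pos (inv_pos.mpr this), inv_mul_cancel₀ this.ne']
  · intro φ hφ
    let ψ : EuclideanSpace 𝕂 (Fin N) →L[𝕂] 𝕂 := φ ∘L F.subtypeL ∘L T
    have hψ : ‖ψ‖ ≤ 1 := by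
      refine ContinuousLinearMap.opNorm_le_bound _ zero_le_one fun x => ?_
      have h1 := φ.le_of_opNorm_le hφ (T x : E)
      have h2 := T.le_of_opNorm_le hT x
      have h3 : ‖(T x : E)‖ = ‖T x‖ := rfl
      have h4 : ψ x = φ (T x : E) := rfl
      rw [h4]
      linarith
    let z := (InnerProductSpace.toDual 𝕂 (EuclideanSpace 𝕂 (Fin N))).symm ψ
    have hz : ∀ x, inner 𝕂 z x = ψ x := fun x => InnerProductSpace.toDual_symm_apply
    have hz1 : ‖z‖ ≤ 1 := by simpa [z] using hψ
    have hon : Orthonormal 𝕂 (fun i : Fin m => b (e i)) :=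
      b.orthonormal.comp e (Fin.castLE_injective hmN)
    have hbes := hon.sum_inner_products_le z (s := Finset.univ)
    have hle : ∀ i : Fin m,
        ‖φ (((‖(T (b (e i)) : E)‖⁻¹ : ℝ) : 𝕂) • (T (b (e i)) : E))‖ ^ 2 ≤
          (c ^ 2)⁻¹ * ‖inner 𝕂 (b (e i)) z‖ ^ 2 := by
      intro i
      have hp : 0 < ‖(T (b (e i)) : E)‖ := hc0.trans_le (he i)
      rw [norm_inner_symm, hz, map_smul, norm_smul, RCLike.norm_ofReal,
        abs_of_pos (inv_pos.mpr hp), mul_pow, ← inv_pow]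
      have h4 : ψ (b (e i)) = φ (T (b (e i)) : E) := rfl
      rw [h4]
      have := he i
      gcongr
    calc _ ≤ ∑ i : Fin m, (c ^ 2)⁻¹ * ‖inner 𝕂 (b (e i)) z‖ ^ 2 :=
          Finset.sum_le_sum fun i _ => hle i
      _ ≤ (1 + δ) * 1 := by
          rw [← Finset.mul_sum, hcδ]
          gcongr
          exact hbes.trans (pow_le_one₀ (norm_nonneg _) hz1)
      _ = 1 + δ := mul_one _


/-- Theorem 3 (Dineen). If `E` is an infinite-dimensional Banach
space over `𝕂 = ℝ` or `ℂ`, `n ≥ 2`, `m ≥ 1` and `ε > 0`, then there exist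
`x₁, …, x_m ∈ E` such that for all scalars `α₁, …, α_m`,
`max_i |α_i| ≤ sup { |Σ_i α_i φ(x_i)^n| : φ ∈ B_{E′} } ≤ (1+ε)^n · max_i |α_i|`;
i.e. the span of the tensors `x_i ⊗ ⋯ ⊗ x_i` in the `n`-fold symmetric injective
tensor product is `(1+ε)^n`-isomorphic to `ℓ∞^m`, whence `ℓ∞` is finitely
represented in that tensor product and in `𝒫(ⁿE)`. -/
theorem stmt_6 {𝕂 : Type*} [RCLike 𝕂] {E : Type*} [NormedAddCommGroup E]
    [NormedSpace 𝕂 E] [CompleteSpace E] (hinf : ¬ FiniteDimensional 𝕂 E)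
    {n : ℕ} (hn : 2 ≤ n) {m : ℕ} (hm : 0 < m) {ε : ℝ} (hε : 0 < ε) :
    ∃ x : Fin m → E, ∀ α : Fin m → 𝕂,
      (⨆ i, ‖α i‖) ≤
        sSup {s : ℝ | ∃ φ : E →L[𝕂] 𝕂, ‖φ‖ ≤ 1 ∧
          s = ‖∑ i, α i * (φ (x i)) ^ n‖} ∧
      sSup {s : ℝ | ∃ φ : E →L[𝕂] 𝕂, ‖φ‖ ≤ 1 ∧
          s = ‖∑ i, α i * (φ (x i)) ^ n‖} ≤ (1 + ε) ^ n * ⨆ i, ‖α i‖ := by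
  obtain ⟨δ, hδ⟩ : ∃ δ : ℝ, δ = ε / (2 + ε) := ⟨_, rfl⟩
  have hδ0 : 0 < δ := by rw [hδ]; positivity
  have hδ1 : δ < 1 := by rw [hδ, div_lt_one (by positivity)]; linarith
  have h1δ : 0 < 1 - δ := by linarith
  have hδε : (1 - δ)⁻¹ * (1 + δ) = 1 + ε := by
    rw [inv_mul_eq_iff_eq_mul₀ h1δ.ne', hδ]
    field_simp
    ring
  obtain ⟨y, hy1, hy⟩ := dr_core (𝕂 := 𝕂) hinf hm hδ0
  obtain ⟨s, hs0, hs⟩ : ∃ s : ℝ, 0 ≤ s ∧ s ^ n = (1 - δ)⁻¹ :=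
    ⟨((1 - δ)⁻¹) ^ ((n : ℝ)⁻¹), by positivity,
      Real.rpow_inv_natCast_pow (by positivity) (by omega)⟩
  have hne : Nonempty (Fin m) := ⟨⟨0, hm⟩⟩
  refine ⟨fun i => (s : 𝕂) • y i, fun α => ?_⟩
  obtain ⟨R, hR⟩ : ∃ R : ℝ, R = ⨆ i, ‖α i‖ := ⟨_, rfl⟩
  have hαR : ∀ i, ‖α i‖ ≤ R := fun i =>
    hR ▸ le_ciSup (f := fun i => ‖α i‖) (Set.finite_range _).bddAbove i
  have hR0 : 0 ≤ R := (norm_nonneg _).trans (hαR ⟨0, hm⟩)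
  rw [← hR]
  have hterm : ∀ (φ : E →L[𝕂] 𝕂), ‖φ‖ ≤ 1 → ∀ i,
      ‖α i * (φ ((s : 𝕂) • y i)) ^ n‖ ≤ R * (1 - δ)⁻¹ * ‖φ (y i)‖ ^ 2 := by
    intro φ hφ i
    have h1 : ‖φ (y i)‖ ≤ 1 := by
      have := φ.le_of_opNorm_le hφ (y i)
      rwa [hy1, mul_one] at this
    have h2 : ‖φ (y i)‖ ^ n ≤ ‖φ (y i)‖ ^ 2 := pow_le_pow_of_le_one (norm_nonneg _) h1 hn
    rw [norm_mul, norm_pow, map_smul, norm_smul, mul_pow, RCLike.norm_ofReal,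
      abs_of_nonneg hs0, hs, ← mul_assoc]
    have := hαR i
    gcongr
  have hup : ∀ t ∈ {t : ℝ | ∃ φ : E →L[𝕂] 𝕂, ‖φ‖ ≤ 1 ∧
      t = ‖∑ i, α i * (φ ((s : 𝕂) • y i)) ^ n‖}, t ≤ (1 + ε) ^ n * R := by
    rintro t ⟨φ, hφ, rfl⟩
    calc _ ≤ ∑ i, ‖α i * (φ ((s : 𝕂) • y i)) ^ n‖ := norm_sum_le _ _
      _ ≤ ∑ i, R * (1 - δ)⁻¹ * ‖φ (y i)‖ ^ 2 := Finset.sum_le_sum fun i _ => hterm φ hφ i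
      _ = R * (1 - δ)⁻¹ * ∑ i, ‖φ (y i)‖ ^ 2 := by rw [Finset.mul_sum]
      _ ≤ R * (1 - δ)⁻¹ * (1 + δ) := by
          gcongr
          exact hy φ hφ
      _ = (1 + ε) * R := by rw [mul_assoc, hδε, mul_comm]
      _ ≤ (1 + ε) ^ n * R := by
          gcongr
          exact le_self_pow₀ (by linarith) (by omega)
  refine ⟨?_, csSup_le ⟨_, 0, by simp, rfl⟩ hup⟩
  obtain ⟨i₀, hi₀⟩ := exists_eq_ciSup_of_finite (f := fun i => ‖α i‖)
  obtain ⟨φ, hφ, hφy⟩ := exists_dual_vector'' 𝕂 (y i₀)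
  have hφ1 : φ (y i₀) = 1 := by rw [hφy, hy1]; simp
  refine le_trans ?_ (le_csSup ⟨_, hup⟩ ⟨φ, hφ, rfl⟩)
  have hsum := hy φ hφ
  rw [← Finset.add_sum_erase _ _ (Finset.mem_univ i₀), hφ1] at hsum
  rw [← Finset.add_sum_erase _ _ (Finset.mem_univ i₀)]
  have hmain : ‖α i₀ * (φ ((s : 𝕂) • y i₀)) ^ n‖ = R * (1 - δ)⁻¹ := by
    rw [norm_mul, norm_pow, map_smul, norm_smul, mul_pow, RCLike.norm_ofReal,
      abs_of_nonneg hs0, hs, hφ1, hR, ← hi₀]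
    simp
  have hrest : ‖∑ i ∈ Finset.univ.erase i₀, α i * (φ ((s : 𝕂) • y i)) ^ n‖ ≤
      R * (1 - δ)⁻¹ * δ := by
    calc _ ≤ ∑ i ∈ Finset.univ.erase i₀, ‖α i * (φ ((s : 𝕂) • y i)) ^ n‖ := norm_sum_le _ _
      _ ≤ ∑ i ∈ Finset.univ.erase i₀, R * (1 - δ)⁻¹ * ‖φ (y i)‖ ^ 2 :=
          Finset.sum_le_sum fun i _ => hterm φ hφ i
      _ = R * (1 - δ)⁻¹ * ∑ i ∈ Finset.univ.erase i₀, ‖φ (y i)‖ ^ 2 := by rw [Finset.mul_sum]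
      _ ≤ R * (1 - δ)⁻¹ * δ := by
          gcongr
          simp only [norm_one, one_pow] at hsum
          linarith
  have hfin : R = R * (1 - δ)⁻¹ - R * (1 - δ)⁻¹ * δ := by
    field_simp
  have htri := norm_sub_le_norm_add (α i₀ * (φ ((s : 𝕂) • y i₀)) ^ n)
    (∑ i ∈ Finset.univ.erase i₀, α i * (φ ((s : 𝕂) • y i)) ^ n)
  linarith
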